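/- Let T = △(e(1,0), e(0,1), e(1,1)) with e(1,0)+e(0,1)+e(1,1) = (0,0), and set e(0,0) := (0,0). For X = (ξ_{ij}) ∈ 𝔽₂^{n×2}, 1 ≤ i ≤ n, and σ ∈ 𝔽₂²∖{(0,0)}, define φ_X^{(i)}(σ) := φ^{(i)}(X) + (η_{i+1}(X)/2^i)·e(σ). Then T^{(i)}(X) = △(φ_X^{(i)}(1,0), φ_X^{(i)}(0,1), φ_X^{(i)}(1,1)); in particular T^{(i)}(X) = φ^{(i)}(X) + (η_{i+1}(X)/2^i)·T, i.e. T^{(i)}(X) = {φ^{(i)}(X) + (η_{i+1}(X)/2^i)·y : y ∈ T}. -/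

import Mathlib

open MeasureTheory

noncomputable section

/-- The two-element field. -/
abbrev F2 : Type := ZMod 2

/-- Points of the plane. -/
abbrev Pt : Type := EuclideanSpace ℝ (Fin 2)

/-- The (closed) triangle with vertices `A`, `B`, `C`. -/
def tri (A B C : Pt) : Set Pt :=
  {x | ∃ w1 w2 w3 : ℝ, 0 ≤ w1 ∧ 0 ≤ w2 ∧ 0 ≤ w3 ∧ w1 + w2 + w3 = 1 ∧
    x = w1 • A + w2 • B + w3 • C}

/-- One step of the recursive partitioning, acting on vertex triples `(A,B,C)`. -/
def subV (v : Pt × Pt × Pt) (ξ : F2 × F2) : Pt × Pt × Pt :=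
  if ξ = (1, 0) then (v.1, (2:ℝ)⁻¹ • (v.1 + v.2.1), (2:ℝ)⁻¹ • (v.1 + v.2.2))
  else if ξ = (0, 1) then ((2:ℝ)⁻¹ • (v.2.1 + v.1), v.2.1, (2:ℝ)⁻¹ • (v.2.1 + v.2.2))
  else if ξ = (1, 1) then ((2:ℝ)⁻¹ • (v.2.2 + v.1), (2:ℝ)⁻¹ • (v.2.2 + v.2.1), v.2.2)
  else ((2:ℝ)⁻¹ • (v.2.1 + v.2.2), (2:ℝ)⁻¹ • (v.2.2 + v.1), (2:ℝ)⁻¹ • (v.1 + v.2.1))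

/-- Iterated partitioning along a list of pairs of bits (the rows of `X`). -/
def vIter (v : Pt × Pt × Pt) (l : List (F2 × F2)) : Pt × Pt × Pt := l.foldl subV v

/-- The subtriangle `T^{(n)}(X)` where `l` is the list of rows of `X`. -/
def subTri (v : Pt × Pt × Pt) (l : List (F2 × F2)) : Set Pt :=
  tri (vIter v l).1 (vIter v l).2.1 (vIter v l).2.2

/-- The centre `φ^{(n)}(X)` of the subtriangle `T^{(n)}(X)`. -/
def ctr (v : Pt × Pt × Pt) (l : List (F2 × F2)) : Pt :=
  (3:ℝ)⁻¹ • ((vIter v l).1 + (vIter v l).2.1 + (vIter v l).2.2)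

/-- The sign `η_i(X)` (with `i` 1-indexed, `1 ≤ i ≤ n+1`). -/
def eta {n : ℕ} (X : Fin n → F2 × F2) (i : ℕ) : ℝ :=
  (-1 : ℝ) ^ (Finset.univ.filter fun a : Fin n => (a : ℕ) + 1 < i ∧ X a = (0, 0)).card

/-- First coordinate direction. -/
def dir1 : Pt := EuclideanSpace.single 0 1

/-- Second coordinate direction. -/
def dir2 : Pt := EuclideanSpace.single 1 1

/-- Partial derivative (within `T`) of `f` in the direction `v`. -/
def pdW (T : Set Pt) (v : Pt) (f : Pt → ℝ) : Pt → ℝ := fun x => fderivWithin ℝ f T x v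

/-- Sup of `|g|` over `T`. -/
def supAbs (T : Set Pt) (g : Pt → ℝ) : ℝ := ⨆ x ∈ T, |g x|

/-- The norm `‖f‖_{C²(T)}`: the maximum over all partial derivatives of order at most 2
of the sup norm on `T`. -/
def c2Norm (T : Set Pt) (f : Pt → ℝ) : ℝ :=
  max (supAbs T f)
    (max (max (supAbs T (pdW T dir1 f)) (supAbs T (pdW T dir2 f)))
      (max (supAbs T (pdW T dir1 (pdW T dir1 f)))
        (max (supAbs T (pdW T dir2 (pdW T dir1 f)))
          (supAbs T (pdW T dir2 (pdW T dir2 f))))))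

/-- The `n`-th discretized function `F_n` of `f` (with `X` given by its rows). -/
def discF (v : Pt × Pt × Pt) {n : ℕ} (f : Pt → ℝ) (X : Fin n → F2 × F2) : ℝ :=
  (volume (subTri v (List.ofFn X))).toReal⁻¹ * ∫ y in subTri v (List.ofFn X), f y

/-- The `l`-th dyadic digit of `h`. -/
def digit (h l : ℕ) : F2 := if Nat.testBit h l then 1 else 0

/-- The weight `μ₁(k)` of a column vector: the largest (1-indexed) position of a
nonzero entry, and `0` for the zero vector. -/
def mu1 {n : ℕ} (k : Fin n → F2) : ℕ :=
  (Finset.univ.filter fun i : Fin n => k i ≠ 0).sup fun i => (i : ℕ) + 1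

/-- The weight `v(K) = max (μ₁(k₁), μ₁(k₂))` of `K` (given by its rows). -/
def vK {n : ℕ} (K : Fin n → F2 × F2) : ℕ :=
  max (mu1 fun i => (K i).1) (mu1 fun i => (K i).2)

/-- Entry `(i, j)` (0-indexed row `i`) of the point `X(h)` of the digital sequence with
generating matrices `Cm 0`, `Cm 1` (0-indexed). -/
def Xent (Cm : Fin 2 → ℕ → ℕ → F2) (h i : ℕ) (j : Fin 2) : F2 :=
  ∑ l ∈ Finset.range (h + 1), Cm j i l * digit h l

/-- Row `i` (0-indexed) of the point `X(h)` of the digital sequence. -/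
def XrowS (Cm : Fin 2 → ℕ → ℕ → F2) (h i : ℕ) : F2 × F2 :=
  (Xent Cm h i 0, Xent Cm h i 1)

/-- `ν(h)`: the number of initial rows of `X(h)` after which all rows vanish. -/
def nuF (Cm : Fin 2 → ℕ → ℕ → F2) (h : ℕ) : ℕ :=
  sInf {q | ∀ i, q ≤ i → XrowS Cm h i = (0, 0)}

/-- The `h`-th point of the sequence `S_T` in the triangle with vertex triple `v`. -/
def seqPt (v : Pt × Pt × Pt) (Cm : Fin 2 → ℕ → ℕ → F2) (h : ℕ) : Pt :=
  ctr v (List.ofFn fun i : Fin (nuF Cm h) => XrowS Cm h (i : ℕ))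

/-- Row `i` of the digital-net point `X(h)` for generating matrices `C1 C2 ∈ 𝔽₂^{n×m}`. -/
def XnetRow {n m : ℕ} (C1 C2 : Matrix (Fin n) (Fin m) F2) (h : ℕ) (i : Fin n) : F2 × F2 :=
  (∑ l : Fin m, C1 i l * digit h (l : ℕ), ∑ l : Fin m, C2 i l * digit h (l : ℕ))

/-- The Walsh function `wal_K(X)` (for `K`, `X` given by their rows). -/
def walR {n : ℕ} (K X : Fin n → F2 × F2) : ℝ :=
  (-1 : ℝ) ^ (∑ i : Fin n, ((K i).1 * (X i).1 + (K i).2 * (X i).2)).val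

/-- The `K`-th Walsh coefficient of `F : 𝔽₂^{n×2} → ℝ`. -/
def fhat {n : ℕ} (F : (Fin n → F2 × F2) → ℝ) (K : Fin n → F2 × F2) : ℝ :=
  ((4:ℝ) ^ n)⁻¹ * ∑ X : Fin n → F2 × F2, F X * walR K X

/-- The vector `τ(κ, κ')`. -/
def tau (e : F2 × F2 → Pt) (κ κ' : F2 × F2) : Pt :=
  if κ' ≠ (0, 0) ∧ κ' ≠ κ then e (κ + κ') - e κ' else e (κ + κ') + e κ'

/-- The point shift `y ⊕_i κ` on `T^{(n)}(X)` (with `i : Fin n` the 0-indexed row,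
corresponding to the 1-indexed row `i+1` of the paper). -/
def ptShift (e : F2 × F2 → Pt) {n : ℕ} (X : Fin n → F2 × F2) (i : Fin n)
    (κ : F2 × F2) (y : Pt) : Pt :=
  if X i ≠ (0, 0) ∧ X i ≠ κ then
    y + (eta X ((i : ℕ) + 1) / 2 ^ ((i : ℕ) + 1)) • tau e κ (X i)
  else
    (2:ℝ) • ctr (e (1, 0), e (0, 1), e (1, 1)) ((List.ofFn X).take (i : ℕ)) - y +
      (eta X ((i : ℕ) + 1) / 2 ^ ((i : ℕ) + 1)) • tau e κ (X i)

/-- The map `σ : 𝔽₂² → 𝔽₂²`. -/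
def sigF : F2 × F2 → F2 × F2 := fun κ =>
  if κ = (0, 0) then (1, 1) else if κ = (1, 1) then (0, 1) else κ

/-- The two-element set `P(κ) = {p₁(κ), p₂(κ)}`. -/
def pSet (κ : F2 × F2) : Finset (F2 × F2) :=
  if κ = (0, 0) then {(0, 0), (1, 1)} else if κ = (0, 1) then {(1, 1), (1, 0)}
  else if κ = (1, 0) then {(1, 1), (0, 1)} else {(1, 0), (1, 1)}

/-- The one-row Walsh function `wal_κ(ξ)`. -/
def walRow (κ ξ : F2 × F2) : ℝ := (-1 : ℝ) ^ ((κ.1 * ξ.1 + κ.2 * ξ.2 : F2)).val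

/-- The `i`-th dyadic difference `d_K^{(i)} F` (with `i : Fin n` 0-indexed, corresponding
to the 1-indexed index `i+1` of the paper). -/
def dd {n : ℕ} (K : Fin n → F2 × F2) (i : Fin n) (F : (Fin n → F2 × F2) → ℝ) :
    (Fin n → F2 × F2) → ℝ :=
  fun X => F (Function.update X i (X i + sigF (K i))) + walRow (K i) (sigF (K i)) * F X

/-- The subset `R_w(K) ⊆ 𝔽₂^{n×2}` (here `w : ℕ` is the 1-indexed paper index,
`0 ≤ w ≤ v(K)-1`). -/
def Rset {n : ℕ} (K : Fin n → F2 × F2) (w : ℕ) : Finset (Fin n → F2 × F2) :=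
  Finset.univ.filter fun X =>
    (∀ i : Fin n, w ≤ (i : ℕ) → (i : ℕ) + 1 < vK K → X i ∉ pSet (K i)) ∧
    (w = 0 ∨ ∃ j : Fin n, (j : ℕ) + 1 = w ∧ X j ∈ pSet (K j))

/-- The Walsh coefficient of `F` on the subset `R_w(K)`. -/
def rwHat {n : ℕ} (F : (Fin n → F2 × F2) → ℝ) (K : Fin n → F2 × F2) (w : ℕ) : ℝ :=
  ((4:ℝ) ^ n)⁻¹ * ∑ X ∈ Rset K w, F X * walR K X

theorem eta_one {n : ℕ} (X : Fin n → F2 × F2) : eta X 1 = 1 := by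
  simp [eta]

theorem eta_succ {n : ℕ} (X : Fin n → F2 × F2) (i : Fin n) :
    eta X ((i : ℕ) + 2) = (if X i = (0, 0) then -1 else 1) * eta X ((i : ℕ) + 1) := by
  unfold eta
  split_ifs with h
  · have hins : (Finset.univ.filter fun a : Fin n => (a : ℕ) + 1 < i + 2 ∧ X a = (0, 0)) =
        insert i (Finset.univ.filter fun a : Fin n => (a : ℕ) + 1 < i + 1 ∧ X a = (0, 0)) := by
      ext a
      simp only [Finset.mem_filter, Finset.mem_univ, true_and, Finset.mem_insert]
      constructor
      · rintro ⟨h1, h2⟩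
        by_cases hai : a = i
        · exact Or.inl hai
        · have := Fin.val_ne_of_ne hai
          exact Or.inr ⟨by omega, h2⟩
      · rintro (rfl | ⟨h1, h2⟩)
        · exact ⟨by omega, h⟩
        · exact ⟨by omega, h2⟩
    rw [hins, Finset.card_insert_of_notMem (by simp), pow_succ']
  · rw [one_mul]
    congr 2
    ext a
    simp only [Finset.mem_filter, Finset.mem_univ, true_and]
    constructor
    · rintro ⟨h1, h2⟩
      have hai : a ≠ i := by
        rintro rfl
        exact h h2
      have := Fin.val_ne_of_ne hai
      exact ⟨by omega, h2⟩
    · rintro ⟨h1, h2⟩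
      exact ⟨by omega, h2⟩

/-- One partitioning step sends a homothetic copy of a triangle centred at the origin to another
such copy, with half the ratio and with reversed orientation for the middle triangle. -/
theorem exists_subV_eq {A B C : Pt} (h : A + B + C = 0) (p : Pt) (c : ℝ) (ξ : F2 × F2) :
    ∃ q : Pt, subV (p + c • A, p + c • B, p + c • C) ξ =
      (q + ((if ξ = (0, 0) then -1 else 1) * c / 2) • A,
        q + ((if ξ = (0, 0) then -1 else 1) * c / 2) • B,
        q + ((if ξ = (0, 0) then -1 else 1) * c / 2) • C) := by
  obtain rfl : C = -(A + B) := (neg_eq_of_add_eq_zero_right h).symm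
  have hξ : ξ = (0, 0) ∨ ξ = (1, 0) ∨ ξ = (0, 1) ∨ ξ = (1, 1) := by
    revert ξ
    decide
  rcases hξ with rfl | rfl | rfl | rfl
  · refine ⟨p, ?_⟩
    simp only [subV, Prod.mk.injEq, zero_ne_one, and_true, and_false, and_self, if_true, if_false]
    refine ⟨?_, ?_, ?_⟩ <;> module
  · refine ⟨p + (c / 2) • A, ?_⟩
    simp only [subV, Prod.mk.injEq, one_ne_zero, and_true, if_true, if_false]
    refine ⟨?_, ?_, ?_⟩ <;> module
  · refine ⟨p + (c / 2) • B, ?_⟩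
    simp only [subV, Prod.mk.injEq, zero_ne_one, one_ne_zero, and_false, and_self, if_true,
      if_false]
    refine ⟨?_, ?_, ?_⟩ <;> module
  · refine ⟨p + (c / 2) • -(A + B), ?_⟩
    simp only [subV, Prod.mk.injEq, one_ne_zero, and_false, false_and, and_self, if_true, if_false]
    refine ⟨?_, ?_, ?_⟩ <;> module

theorem exists_vIter_take_eq {A B C : Pt} (h : A + B + C = 0) {n : ℕ} (X : Fin n → F2 × F2)
    {i : ℕ} (hi : i ≤ n) :
    ∃ p : Pt, vIter (A, B, C) ((List.ofFn X).take i) =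
      (p + (eta X (i + 1) / 2 ^ i) • A, p + (eta X (i + 1) / 2 ^ i) • B,
        p + (eta X (i + 1) / 2 ^ i) • C) := by
  induction i with
  | zero => exact ⟨0, by simp [vIter, eta_one]⟩
  | succ i ih =>
    obtain ⟨p, hp⟩ := ih (by omega)
    obtain ⟨q, hq⟩ := exists_subV_eq h p (eta X (i + 1) / 2 ^ i) (X ⟨i, hi⟩)
    refine ⟨q, ?_⟩
    have hc : eta X (i + 1 + 1) / 2 ^ (i + 1) =
        (if X ⟨i, hi⟩ = (0, 0) then -1 else 1) * (eta X (i + 1) / 2 ^ i) / 2 := by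
      rw [show eta X (i + 1 + 1) = _ from eta_succ X ⟨i, hi⟩, pow_succ, ← mul_div_assoc, div_div]
    rw [hc, ← hq, ← hp, List.take_succ_eq_append_getElem (by simpa using hi)]
    simp [vIter]

/-- The vertices of a subtriangle in terms of its centre. -/
theorem vIter_take_eq {A B C : Pt} (h : A + B + C = 0) {n : ℕ} (X : Fin n → F2 × F2)
    {i : ℕ} (hi : i ≤ n) :
    vIter (A, B, C) ((List.ofFn X).take i) =
      (ctr (A, B, C) ((List.ofFn X).take i) + (eta X (i + 1) / 2 ^ i) • A,
        ctr (A, B, C) ((List.ofFn X).take i) + (eta X (i + 1) / 2 ^ i) • B,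
        ctr (A, B, C) ((List.ofFn X).take i) + (eta X (i + 1) / 2 ^ i) • C) := by
  obtain ⟨p, hp⟩ := exists_vIter_take_eq h X hi
  have hctr : ctr (A, B, C) ((List.ofFn X).take i) = p := by
    obtain rfl : C = -(A + B) := (neg_eq_of_add_eq_zero_right h).symm
    rw [ctr, hp]
    module
  rw [hctr, hp]

theorem subTri_take_eq {A B C : Pt} (h : A + B + C = 0) {n : ℕ} (X : Fin n → F2 × F2)
    {i : ℕ} (hi : i ≤ n) :
    subTri (A, B, C) ((List.ofFn X).take i) =
      tri (ctr (A, B, C) ((List.ofFn X).take i) + (eta X (i + 1) / 2 ^ i) • A)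
        (ctr (A, B, C) ((List.ofFn X).take i) + (eta X (i + 1) / 2 ^ i) • B)
        (ctr (A, B, C) ((List.ofFn X).take i) + (eta X (i + 1) / 2 ^ i) • C) := by
  rw [subTri, vIter_take_eq h X hi]

theorem tri_add_smul (A B C p : Pt) (c : ℝ) :
    tri (p + c • A) (p + c • B) (p + c • C) = (fun y => p + c • y) '' tri A B C := by
  have key (w1 w2 w3 : ℝ) (hw : w1 + w2 + w3 = 1) :
      p + c • (w1 • A + w2 • B + w3 • C) =
        w1 • (p + c • A) + w2 • (p + c • B) + w3 • (p + c • C) := by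
    obtain rfl : w3 = 1 - w1 - w2 := by linarith
    module
  ext x
  constructor
  · rintro ⟨w1, w2, w3, h1, h2, h3, hw, rfl⟩
    exact ⟨_, ⟨w1, w2, w3, h1, h2, h3, hw, rfl⟩, key w1 w2 w3 hw⟩
  · rintro ⟨_, ⟨w1, w2, w3, h1, h2, h3, hw, rfl⟩, rfl⟩
    exact ⟨w1, w2, w3, h1, h2, h3, hw, key w1 w2 w3 hw⟩

/-- Lemma 1, part 2. The subregion `T^{(i)}(X)` is the triangle with
vertices `φ^{(i)}(X) + (η_{i+1}(X)/2^i) e(σ)`, `σ ∈ 𝔽₂² \ {0}`; in particular it is the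
scaled translate `φ^{(i)}(X) + (η_{i+1}(X)/2^i) T` of `T`. -/
theorem statement4 (e : F2 × F2 → Pt) (he0 : e (0, 0) = 0)
    (hsum : e (1, 0) + e (0, 1) + e (1, 1) = 0)
    {n : ℕ} (X : Fin n → F2 × F2) (i : ℕ) (h1 : 1 ≤ i) (h2 : i ≤ n) :
    subTri (e (1, 0), e (0, 1), e (1, 1)) ((List.ofFn X).take i) =
      tri (ctr (e (1, 0), e (0, 1), e (1, 1)) ((List.ofFn X).take i) +
            (eta X (i + 1) / 2 ^ i) • e (1, 0))
          (ctr (e (1, 0), e (0, 1), e (1, 1)) ((List.ofFn X).take i) +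
            (eta X (i + 1) / 2 ^ i) • e (0, 1))
          (ctr (e (1, 0), e (0, 1), e (1, 1)) ((List.ofFn X).take i) +
            (eta X (i + 1) / 2 ^ i) • e (1, 1)) ∧
    subTri (e (1, 0), e (0, 1), e (1, 1)) ((List.ofFn X).take i) =
      (fun y => ctr (e (1, 0), e (0, 1), e (1, 1)) ((List.ofFn X).take i) +
          (eta X (i + 1) / 2 ^ i) • y) '' tri (e (1, 0)) (e (0, 1)) (e (1, 1)) := by
  have hv := subTri_take_eq hsum X h2
  exact ⟨hv, hv.trans (tri_add_smul _ _ _ _ _)⟩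

end
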